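/- For n ≥ 3, with g = e_2r_1e_0e_1e_2, the following equalities hold in Br(B_n): (i) g = e_2e_1e_0r_1e_2 (so that g is invariant under the anti-involution reversing words in the generators); (ii) (r_1r_0r_1)·e_2r_1e_0e_1 = e_2r_1e_0e_1; (iii) (r_1r_0r_1)·g = g; (iv) e_0·g = δ·e_0e_2. -/

import Mathlib

/-- The ground ring `ℤ[δ, δ⁻¹]` of Laurent polynomials over `ℤ`. -/
abbrev Lp : Type := LaurentPolynomial ℤ

/-- The parameter `δ`. -/
noncomputable def δpar : Lp := LaurentPolynomial.T 1

/-- Generators of the Brauer algebra of type `B_n`: `r i` and `e i` for `0 ≤ i ≤ n-1`. -/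
inductive BGen (n : ℕ) : Type
  | r (i : Fin n) : BGen n
  | e (i : Fin n) : BGen n

/-- The generator `r i` viewed in the free algebra. -/
noncomputable def fr {n : ℕ} (i : Fin n) : FreeAlgebra Lp (BGen n) :=
  FreeAlgebra.ι Lp (BGen.r i)

/-- The generator `e i` viewed in the free algebra. -/
noncomputable def fe {n : ℕ} (i : Fin n) : FreeAlgebra Lp (BGen n) :=
  FreeAlgebra.ι Lp (BGen.e i)

/-- The defining relations of the Brauer algebra of type `B_n`. -/
inductive BrauerBRel (n : ℕ) : FreeAlgebra Lp (BGen n) → FreeAlgebra Lp (BGen n) → Prop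
  | rr (i : Fin n) : BrauerBRel n (fr i * fr i) 1
  | re (i : Fin n) : BrauerBRel n (fr i * fe i) (fe i)
  | er (i : Fin n) : BrauerBRel n (fe i * fr i) (fe i)
  | ee (i : Fin n) (h : 0 < i.val) : BrauerBRel n (fe i * fe i) (δpar • fe i)
  | e0e0 (i : Fin n) (h : i.val = 0) : BrauerBRel n (fe i * fe i) ((δpar * δpar) • fe i)
  | rrFar (i j : Fin n) (h : i.val + 2 ≤ j.val ∨ j.val + 2 ≤ i.val) :
      BrauerBRel n (fr i * fr j) (fr j * fr i)
  | erFar (i j : Fin n) (h : i.val + 2 ≤ j.val ∨ j.val + 2 ≤ i.val) :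
      BrauerBRel n (fe i * fr j) (fr j * fe i)
  | eeFar (i j : Fin n) (h : i.val + 2 ≤ j.val ∨ j.val + 2 ≤ i.val) :
      BrauerBRel n (fe i * fe j) (fe j * fe i)
  | braid (i j : Fin n) (h : i.val + 1 = j.val ∨ j.val + 1 = i.val)
      (hi : 0 < i.val) (hj : 0 < j.val) :
      BrauerBRel n (fr i * fr j * fr i) (fr j * fr i * fr j)
  | rre (i j : Fin n) (h : i.val + 1 = j.val ∨ j.val + 1 = i.val)
      (hi : 0 < i.val) (hj : 0 < j.val) :
      BrauerBRel n (fr j * fr i * fe j) (fe i * fe j)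
  | rer (i j : Fin n) (h : i.val + 1 = j.val ∨ j.val + 1 = i.val)
      (hi : 0 < i.val) (hj : 0 < j.val) :
      BrauerBRel n (fr i * fe j * fr i) (fr j * fe i * fr j)
  | b1010 (i j : Fin n) (h0 : i.val = 0) (h1 : j.val = 1) :
      BrauerBRel n (fr j * fr i * fr j * fr i) (fr i * fr j * fr i * fr j)
  | b_r0r1e0 (i j : Fin n) (h0 : i.val = 0) (h1 : j.val = 1) :
      BrauerBRel n (fr i * fr j * fe i) (fr j * fe i)
  | b_r0e1r0e1 (i j : Fin n) (h0 : i.val = 0) (h1 : j.val = 1) :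
      BrauerBRel n (fr i * fe j * fr i * fe j) (fe j * fe i * fe j)
  | b_r0r1r0e1 (i j : Fin n) (h0 : i.val = 0) (h1 : j.val = 1) :
      BrauerBRel n (fr i * fr j * fr i * fe j) (fe j * (fr i * fr j * fr i))
  | b_e0r1e0 (i j : Fin n) (h0 : i.val = 0) (h1 : j.val = 1) :
      BrauerBRel n (fe i * fr j * fe i) (δpar • fe i)
  | b_e0e1e0 (i j : Fin n) (h0 : i.val = 0) (h1 : j.val = 1) :
      BrauerBRel n (fe i * fe j * fe i) (δpar • fe i)
  | b_e0r1r0 (i j : Fin n) (h0 : i.val = 0) (h1 : j.val = 1) :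
      BrauerBRel n (fe i * fr j * fr i) (fe i * fr j)
  | b_e0e1r0 (i j : Fin n) (h0 : i.val = 0) (h1 : j.val = 1) :
      BrauerBRel n (fe i * fe j * fr i) (fe i * fe j)

/-- The Brauer algebra of type `B_n` over `ℤ[δ, δ⁻¹]`. -/
abbrev BrauerB (n : ℕ) : Type := RingQuot (BrauerBRel n)

/-- The generator `r i` of `Br(B_n)` (defined to be `1` for out-of-range indices). -/
noncomputable def rb (n : ℕ) (i : ℕ) : BrauerB n :=
  if h : i < n then RingQuot.mkAlgHom Lp (BrauerBRel n) (fr ⟨i, h⟩) else 1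

/-- The generator `e i` of `Br(B_n)` (defined to be `1` for out-of-range indices). -/
noncomputable def eb (n : ℕ) (i : ℕ) : BrauerB n :=
  if h : i < n then RingQuot.mkAlgHom Lp (BrauerBRel n) (fe ⟨i, h⟩) else 1

theorem isUnit_δpar : IsUnit δpar :=
  LaurentPolynomial.isUnit_T 1

section Relations

variable {n : ℕ}

theorem mkAlgHom_fr (i : Fin n) :
    RingQuot.mkAlgHom Lp (BrauerBRel n) (fr i) = rb n i := by
  rw [rb, dif_pos i.isLt]

theorem mkAlgHom_fe (i : Fin n) :
    RingQuot.mkAlgHom Lp (BrauerBRel n) (fe i) = eb n i := by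
  rw [eb, dif_pos i.isLt]

theorem rb_mul_self {i : ℕ} (hi : i < n) :
    rb n i * rb n i = 1 := by
  simpa only [map_mul, map_smul, map_one, mkAlgHom_fr, mkAlgHom_fe] using
    RingQuot.mkAlgHom_rel Lp (BrauerBRel.rr ⟨i, hi⟩)

theorem eb_mul_self {i : ℕ} (hi : i < n) (hi₀ : 0 < i) :
    eb n i * eb n i = δpar • eb n i := by
  simpa only [map_mul, map_smul, map_one, mkAlgHom_fr, mkAlgHom_fe] using
    RingQuot.mkAlgHom_rel Lp (BrauerBRel.ee ⟨i, hi⟩ hi₀)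

theorem eb_mul_rb_comm {i j : ℕ} (hi : i < n) (hj : j < n) (h : i + 2 ≤ j ∨ j + 2 ≤ i) :
    eb n i * rb n j = rb n j * eb n i := by
  simpa only [map_mul, map_smul, map_one, mkAlgHom_fr, mkAlgHom_fe] using
    RingQuot.mkAlgHom_rel Lp (BrauerBRel.erFar ⟨i, hi⟩ ⟨j, hj⟩ h)

theorem rb_mul_rb_comm {i j : ℕ} (hi : i < n) (hj : j < n) (h : i + 2 ≤ j ∨ j + 2 ≤ i) :
    rb n i * rb n j = rb n j * rb n i := by
  simpa only [map_mul, map_smul, map_one, mkAlgHom_fr, mkAlgHom_fe] using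
    RingQuot.mkAlgHom_rel Lp (BrauerBRel.rrFar ⟨i, hi⟩ ⟨j, hj⟩ h)

theorem eb_mul_eb_comm {i j : ℕ} (hi : i < n) (hj : j < n) (h : i + 2 ≤ j ∨ j + 2 ≤ i) :
    eb n i * eb n j = eb n j * eb n i := by
  simpa only [map_mul, map_smul, map_one, mkAlgHom_fr, mkAlgHom_fe] using
    RingQuot.mkAlgHom_rel Lp (BrauerBRel.eeFar ⟨i, hi⟩ ⟨j, hj⟩ h)

theorem rb_mul_rb_mul_eb {i j : ℕ} (hi : i < n) (hj : j < n) (h : i + 1 = j ∨ j + 1 = i)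
    (hi₀ : 0 < i) (hj₀ : 0 < j) :
    rb n j * rb n i * eb n j = eb n i * eb n j := by
  simpa only [map_mul, map_smul, map_one, mkAlgHom_fr, mkAlgHom_fe] using
    RingQuot.mkAlgHom_rel Lp (BrauerBRel.rre ⟨i, hi⟩ ⟨j, hj⟩ h hi₀ hj₀)

theorem rb_mul_eb_mul_rb {i j : ℕ} (hi : i < n) (hj : j < n) (h : i + 1 = j ∨ j + 1 = i)
    (hi₀ : 0 < i) (hj₀ : 0 < j) :
    rb n i * eb n j * rb n i = rb n j * eb n i * rb n j := by
  simpa only [map_mul, map_smul, map_one, mkAlgHom_fr, mkAlgHom_fe] using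
    RingQuot.mkAlgHom_rel Lp (BrauerBRel.rer ⟨i, hi⟩ ⟨j, hj⟩ h hi₀ hj₀)

theorem rb_zero_eb_one_rb_zero_eb_one (hn : 2 ≤ n) :
    rb n 0 * eb n 1 * rb n 0 * eb n 1 = eb n 1 * eb n 0 * eb n 1 := by
  simpa only [map_mul, map_smul, map_one, mkAlgHom_fr, mkAlgHom_fe] using
    RingQuot.mkAlgHom_rel Lp (BrauerBRel.b_r0e1r0e1 (n := n) ⟨0, by omega⟩ ⟨1, by omega⟩ rfl rfl)

theorem eb_zero_rb_one_eb_zero (hn : 2 ≤ n) :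
    eb n 0 * rb n 1 * eb n 0 = δpar • eb n 0 := by
  simpa only [map_mul, map_smul, map_one, mkAlgHom_fr, mkAlgHom_fe] using
    RingQuot.mkAlgHom_rel Lp (BrauerBRel.b_e0r1e0 (n := n) ⟨0, by omega⟩ ⟨1, by omega⟩ rfl rfl)

theorem eb_zero_eb_one_eb_zero (hn : 2 ≤ n) :
    eb n 0 * eb n 1 * eb n 0 = δpar • eb n 0 := by
  simpa only [map_mul, map_smul, map_one, mkAlgHom_fr, mkAlgHom_fe] using
    RingQuot.mkAlgHom_rel Lp (BrauerBRel.b_e0e1e0 (n := n) ⟨0, by omega⟩ ⟨1, by omega⟩ rfl rfl)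

theorem eb_zero_eb_one_rb_zero (hn : 2 ≤ n) :
    eb n 0 * eb n 1 * rb n 0 = eb n 0 * eb n 1 := by
  simpa only [map_mul, map_smul, map_one, mkAlgHom_fr, mkAlgHom_fe] using
    RingQuot.mkAlgHom_rel Lp (BrauerBRel.b_e0e1r0 (n := n) ⟨0, by omega⟩ ⟨1, by omega⟩ rfl rfl)

theorem eb_mul_rb_mul_rb {i j : ℕ} (hi : i < n) (hj : j < n) (h : i + 1 = j ∨ j + 1 = i)
    (hi₀ : 0 < i) (hj₀ : 0 < j) :
    eb n j * rb n i * rb n j = eb n j * eb n i := by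
  calc eb n j * rb n i * rb n j
    _ = rb n i * rb n i * eb n j * rb n i * rb n j := by rw [rb_mul_self hi, one_mul]
    _ = rb n i * (rb n i * eb n j * rb n i) * rb n j := by simp only [mul_assoc]
    _ = rb n i * (rb n j * eb n i * rb n j) * rb n j := by rw [rb_mul_eb_mul_rb hi hj h hi₀ hj₀]
    _ = rb n i * rb n j * eb n i * (rb n j * rb n j) := by simp only [mul_assoc]
    _ = eb n j * eb n i := by rw [rb_mul_self hj, mul_one, rb_mul_rb_mul_eb hj hi h.symm hj₀ hi₀]

theorem eb_mul_eb_mul_rb {i j : ℕ} (hi : i < n) (hj : j < n) (h : i + 1 = j ∨ j + 1 = i)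
    (hi₀ : 0 < i) (hj₀ : 0 < j) :
    eb n j * eb n i * rb n j = eb n j * rb n i := by
  rw [← eb_mul_rb_mul_rb hi hj h hi₀ hj₀, mul_assoc, rb_mul_self hj, mul_one]

theorem rb_mul_eb_mul_eb {i j : ℕ} (hi : i < n) (hj : j < n) (h : i + 1 = j ∨ j + 1 = i)
    (hi₀ : 0 < i) (hj₀ : 0 < j) :
    rb n j * eb n i * eb n j = rb n i * eb n j := by
  rw [mul_assoc, ← rb_mul_rb_mul_eb hi hj h hi₀ hj₀, ← mul_assoc, ← mul_assoc,
    rb_mul_self hj, one_mul]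

theorem eb_mul_eb_mul_eb {i j : ℕ} (hi : i < n) (hj : j < n) (h : i + 1 = j ∨ j + 1 = i)
    (hi₀ : 0 < i) (hj₀ : 0 < j) :
    eb n j * eb n i * eb n j = eb n j := by
  calc eb n j * eb n i * eb n j
    _ = rb n i * rb n j * eb n i * eb n j := by rw [rb_mul_rb_mul_eb hj hi h.symm hj₀ hi₀]
    _ = rb n i * (rb n j * eb n i * eb n j) := by simp only [mul_assoc]
    _ = rb n i * rb n i * eb n j := by rw [rb_mul_eb_mul_eb hi hj h hi₀ hj₀, mul_assoc]
    _ = eb n j := by rw [rb_mul_self hi, one_mul]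

theorem eb_one_rb_zero_eb_one_rb_zero (hn : 2 ≤ n) :
    eb n 1 * rb n 0 * eb n 1 * rb n 0 = eb n 1 * rb n 0 * eb n 1 := by
  calc eb n 1 * rb n 0 * eb n 1 * rb n 0
    _ = rb n 0 * rb n 0 * eb n 1 * rb n 0 * eb n 1 * rb n 0 := by
      rw [rb_mul_self (by omega), one_mul]
    _ = rb n 0 * ((rb n 0 * eb n 1 * rb n 0 * eb n 1) * rb n 0) := by simp only [mul_assoc]
    _ = rb n 0 * (eb n 1 * (eb n 0 * eb n 1 * rb n 0)) := by
      rw [rb_zero_eb_one_rb_zero_eb_one hn]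
      simp only [mul_assoc]
    _ = rb n 0 * (rb n 0 * eb n 1 * rb n 0 * eb n 1) := by
      rw [eb_zero_eb_one_rb_zero hn, rb_zero_eb_one_rb_zero_eb_one hn, mul_assoc]
    _ = rb n 0 * rb n 0 * (eb n 1 * rb n 0 * eb n 1) := by simp only [mul_assoc]
    _ = eb n 1 * rb n 0 * eb n 1 := by rw [rb_mul_self (by omega), one_mul]

theorem eb_one_eb_zero_eb_one (hn : 2 ≤ n) :
    eb n 1 * eb n 0 * eb n 1 = eb n 1 * rb n 0 * eb n 1 := by
  refine isUnit_δpar.smul_left_cancel.mp ?_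
  calc δpar • (eb n 1 * eb n 0 * eb n 1)
    _ = (eb n 1 * eb n 1) * (eb n 0 * eb n 1) := by
      rw [eb_mul_self (by omega) one_pos, smul_mul_assoc, mul_assoc]
    _ = eb n 1 * (rb n 0 * eb n 1 * rb n 0 * eb n 1) := by
      rw [rb_zero_eb_one_rb_zero_eb_one hn]
      simp only [mul_assoc]
    _ = eb n 1 * rb n 0 * eb n 1 * rb n 0 * eb n 1 := by simp only [mul_assoc]
    _ = eb n 1 * rb n 0 * (eb n 1 * eb n 1) := by rw [eb_one_rb_zero_eb_one_rb_zero hn, mul_assoc]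
    _ = δpar • (eb n 1 * rb n 0 * eb n 1) := by rw [eb_mul_self (by omega) one_pos, mul_smul_comm]

theorem rb_zero_eb_one_eb_zero (hn : 2 ≤ n) :
    rb n 0 * eb n 1 * eb n 0 = eb n 1 * eb n 0 := by
  refine isUnit_δpar.smul_left_cancel.mp ?_
  calc δpar • (rb n 0 * eb n 1 * eb n 0)
    _ = rb n 0 * (eb n 1 * eb n 0 * eb n 1) * eb n 0 := by
      rw [← mul_smul_comm, ← eb_zero_eb_one_eb_zero hn]
      simp only [mul_assoc]
    _ = (rb n 0 * eb n 1 * rb n 0 * eb n 1) * eb n 0 := by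
      rw [eb_one_eb_zero_eb_one hn]
      simp only [mul_assoc]
    _ = eb n 1 * (eb n 0 * eb n 1 * eb n 0) := by
      rw [rb_zero_eb_one_rb_zero_eb_one hn]
      simp only [mul_assoc]
    _ = δpar • (eb n 1 * eb n 0) := by rw [eb_zero_eb_one_eb_zero hn, mul_smul_comm]

end Relations

/-- For `n ≥ 3`, with `g = e₂r₁e₀e₁e₂` in `Br(B_n)`:
(i) `g = e₂e₁e₀r₁e₂` (so `g` is fixed by the word-reversing anti-involution);
(ii) `(r₁r₀r₁)·e₂r₁e₀e₁ = e₂r₁e₀e₁`; (iii) `(r₁r₀r₁)·g = g`; (iv) `e₀·g = δ·e₀e₂`. -/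
theorem statement_9 (n : ℕ) (hn : 3 ≤ n) :
    (eb n 2 * rb n 1 * eb n 0 * eb n 1 * eb n 2 =
      eb n 2 * eb n 1 * eb n 0 * rb n 1 * eb n 2) ∧
    (rb n 1 * rb n 0 * rb n 1 * (eb n 2 * rb n 1 * eb n 0 * eb n 1) =
      eb n 2 * rb n 1 * eb n 0 * eb n 1) ∧
    (rb n 1 * rb n 0 * rb n 1 * (eb n 2 * rb n 1 * eb n 0 * eb n 1 * eb n 2) =
      eb n 2 * rb n 1 * eb n 0 * eb n 1 * eb n 2) ∧
    (eb n 0 * (eb n 2 * rb n 1 * eb n 0 * eb n 1 * eb n 2) =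
      δpar • (eb n 0 * eb n 2)) := by
  have reversal :
      eb n 2 * rb n 1 * eb n 0 * eb n 1 * eb n 2 = eb n 2 * eb n 1 * eb n 0 * rb n 1 * eb n 2 := by
    calc eb n 2 * rb n 1 * eb n 0 * eb n 1 * eb n 2
      _ = eb n 2 * eb n 1 * (rb n 2 * eb n 0) * eb n 1 * eb n 2 := by
        rw [← eb_mul_eb_mul_rb (i := 1) (j := 2) (by omega) (by omega) (by omega) one_pos two_pos]
        simp only [mul_assoc]
      _ = eb n 2 * eb n 1 * eb n 0 * (rb n 2 * eb n 1 * eb n 2) := by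
        rw [← eb_mul_rb_comm (i := 0) (j := 2) (by omega) (by omega) (by omega)]
        simp only [mul_assoc]
      _ = eb n 2 * eb n 1 * eb n 0 * rb n 1 * eb n 2 := by
        rw [rb_mul_eb_mul_eb (i := 1) (j := 2) (by omega) (by omega) (by omega) one_pos two_pos]
        simp only [mul_assoc]
  have fixed :
      rb n 1 * rb n 0 * rb n 1 * (eb n 2 * rb n 1 * eb n 0 * eb n 1) =
        eb n 2 * rb n 1 * eb n 0 * eb n 1 := by
    calc rb n 1 * rb n 0 * rb n 1 * (eb n 2 * rb n 1 * eb n 0 * eb n 1)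
      _ = rb n 1 * rb n 0 * (rb n 1 * eb n 2 * rb n 1) * eb n 0 * eb n 1 := by simp only [mul_assoc]
      _ = rb n 1 * (rb n 0 * rb n 2) * eb n 1 * (rb n 2 * eb n 0) * eb n 1 := by
        rw [rb_mul_eb_mul_rb (i := 1) (j := 2) (by omega) (by omega) (by omega) one_pos two_pos]
        simp only [mul_assoc]
      _ = rb n 1 * rb n 2 * (rb n 0 * eb n 1 * eb n 0) * rb n 2 * eb n 1 := by
        rw [rb_mul_rb_comm (i := 0) (j := 2) (by omega) (by omega) (by omega),
          ← eb_mul_rb_comm (i := 0) (j := 2) (by omega) (by omega) (by omega)]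
        simp only [mul_assoc]
      _ = (rb n 1 * rb n 2 * eb n 1) * (eb n 0 * rb n 2) * eb n 1 := by
        rw [rb_zero_eb_one_eb_zero (by omega)]
        simp only [mul_assoc]
      _ = (eb n 2 * eb n 1 * rb n 2) * eb n 0 * eb n 1 := by
        rw [rb_mul_rb_mul_eb (i := 2) (j := 1) (by omega) (by omega) (by omega) two_pos one_pos,
          eb_mul_rb_comm (i := 0) (j := 2) (by omega) (by omega) (by omega)]
        simp only [mul_assoc]
      _ = eb n 2 * rb n 1 * eb n 0 * eb n 1 := by
        rw [eb_mul_eb_mul_rb (i := 1) (j := 2) (by omega) (by omega) (by omega) one_pos two_pos]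
  refine ⟨reversal, fixed, by rw [← mul_assoc, fixed], ?_⟩
  calc eb n 0 * (eb n 2 * rb n 1 * eb n 0 * eb n 1 * eb n 2)
    _ = (eb n 0 * eb n 2) * rb n 1 * eb n 0 * eb n 1 * eb n 2 := by simp only [mul_assoc]
    _ = eb n 2 * (eb n 0 * rb n 1 * eb n 0) * eb n 1 * eb n 2 := by
      rw [eb_mul_eb_comm (i := 0) (j := 2) (by omega) (by omega) (by omega)]
      simp only [mul_assoc]
    _ = δpar • ((eb n 2 * eb n 0) * (eb n 1 * eb n 2)) := by
      rw [eb_zero_rb_one_eb_zero (by omega)]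
      simp only [mul_smul_comm, smul_mul_assoc, mul_assoc]
    _ = δpar • (eb n 0 * (eb n 2 * eb n 1 * eb n 2)) := by
      rw [← eb_mul_eb_comm (i := 0) (j := 2) (by omega) (by omega) (by omega)]
      simp only [mul_assoc]
    _ = δpar • (eb n 0 * eb n 2) := by
      rw [eb_mul_eb_mul_eb (i := 1) (j := 2) (by omega) (by omega) (by omega) one_pos two_pos]
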